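/- Let Λ₁ = 𝔽₃[e, f]/(e³ − 1, f³ − 1), with B_σ = 1 − (e + f)(1 − e)(1 − f) and B_τ = 1 + (e + f) − (e² + ef + f²) + e²f² in Λ₁, and let G = ℤ/3 × ℤ/3 act 𝔽₃-linearly on Λ₁ by (a, b)·m = B_σ^a B_τ^b m. Let V = {m ∈ Λ₁ : (1 + e + e²)·m = 0 and (1 + f + f²)·m = 0}, a G-stable 𝔽₃-subspace of Λ₁ of dimension 4. Then H¹(G, V) is an 𝔽₃-vector space of dimension 6, and H²(G, V) is an 𝔽₃-vector space of dimension 9. -/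

import Mathlib

/-- `Λ₁ = 𝔽₃[e,f]/(e³-1, f³-1)`: the group ring of `(ℤ/3)²` over `𝔽₃ = ZMod 3`. -/
noncomputable abbrev Lam3 : Type := AddMonoidAlgebra (ZMod 3) (ZMod 3 × ZMod 3)

/-- The group-like generator `e`. -/
noncomputable def eGen : Lam3 := AddMonoidAlgebra.single ((1 : ZMod 3), (0 : ZMod 3)) 1

/-- The group-like generator `f`. -/
noncomputable def fGen : Lam3 := AddMonoidAlgebra.single ((0 : ZMod 3), (1 : ZMod 3)) 1

/-- `B_σ = 1 - (e + f)(1 - e)(1 - f)`. -/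
noncomputable def Bsig : Lam3 := 1 - (eGen + fGen) * (1 - eGen) * (1 - fGen)

/-- `B_τ = 1 + (e + f) - (e² + ef + f²) + e²f²`. -/
noncomputable def Btau : Lam3 :=
  1 + (eGen + fGen) - (eGen ^ 2 + eGen * fGen + fGen ^ 2) + eGen ^ 2 * fGen ^ 2

section Pure

variable {A : Type*} [AddCommGroup A] [Module (ZMod 3) A]

/-- Additive form of the 2-cocycle condition for the action `g • a = a + g.1 • δ a`. -/
def Coc2 (δ : A →ₗ[ZMod 3] A) (f : ZMod 3 × ZMod 3 → ZMod 3 × ZMod 3 → A) : Prop :=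
  ∀ g h j, f (g + h) j + f g h = (f h j + g.1 • δ (f h j)) + f g (h + j)

/-- The coboundary of a 1-cochain. -/
def dOne (δ : A →ₗ[ZMod 3] A) (p : ZMod 3 × ZMod 3 → A) (g h : ZMod 3 × ZMod 3) : A :=
  (p h + g.1 • δ (p h)) - p (g + h) + p g

lemma three_smul_zero (a : A) : a + a + a = 0 := by
  have h : (3 : ZMod 3) • a = 0 := by
    rw [show (3 : ZMod 3) = 0 from by decide, zero_smul]
  rw [← h]; module

lemma coc2_dOne (δ : A →ₗ[ZMod 3] A) (hδ : ∀ a, δ (δ a) = 0) (p : ZMod 3 × ZMod 3 → A) :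
    Coc2 δ (dOne δ p) := by
  intro g h j
  simp only [dOne, map_add, map_sub, map_smul, hδ, add_assoc, Prod.fst_add]
  module

lemma Coc2.sub {δ : A →ₗ[ZMod 3] A} {f f' : ZMod 3 × ZMod 3 → ZMod 3 × ZMod 3 → A}
    (hf : Coc2 δ f) (hf' : Coc2 δ f') : Coc2 δ (fun g h => f g h - f' g h) := by
  intro g h j
  have h1 := hf g h j
  have h2 := hf' g h j
  simp only [map_sub]
  linear_combination (norm := module) h1 - h2

lemma Coc2.zero_left {δ : A →ₗ[ZMod 3] A} {f : ZMod 3 × ZMod 3 → ZMod 3 × ZMod 3 → A}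
    (hf : Coc2 δ f) (j) : f 0 j = f 0 0 := by
  have h1 := hf 0 0 j
  simp only [add_zero, zero_add, Prod.fst_zero, zero_smul] at h1
  exact (add_left_cancel h1).symm

lemma Coc2.eq_zero {δ : A →ₗ[ZMod 3] A} {f : ZMod 3 × ZMod 3 → ZMod 3 × ZMod 3 → A}
    (hf : Coc2 δ f) (hs : ∀ g, f g (1, 0) = 0) (ht : ∀ g, f g (0, 1) = 0) (g h) :
    f g h = 0 := by
  have es : ∀ h, f g (h + (1, 0)) = f g h := by
    intro h
    have := hf g h (1, 0)
    simp only [hs, map_zero, smul_zero, add_zero, zero_add] at this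
    exact this.symm
  have et : ∀ h, f g (h + (0, 1)) = f g h := by
    intro h
    have := hf g h (0, 1)
    simp only [ht, map_zero, smul_zero, add_zero, zero_add] at this
    exact this.symm
  have e0 : ∀ i : ZMod 3, f g (i, 0) = 0 := by
    have h0 : f g (0, 0) = 0 := by
      have := es (0, 0)
      simpa [hs] using this.symm
    have h1 : f g (1, 0) = 0 := hs g
    have h2 : f g (2, 0) = 0 := by
      have := es (1, 0)
      rw [h1] at this
      exact this
    intro i
    fin_cases i
    exacts [h0, h1, h2]
  obtain ⟨i, j⟩ := h
  have e1 : f g (i, 1) = 0 := by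
    have := et (i, 0)
    simpa [e0] using this
  have e2 : f g (i, 2) = 0 := by
    have := et (i, 1)
    rw [e1] at this
    rw [← this]
    simp; rfl
  fin_cases j
  exacts [e0 i, e1, e2]

lemma Coc2.swap {δ : A →ₗ[ZMod 3] A} {f : ZMod 3 × ZMod 3 → ZMod 3 × ZMod 3 → A}
    (hf : Coc2 δ f) (g) : f (g + (1, 0)) (0, 1) - f (g + (0, 1)) (1, 0) =
      (f (1, 0) (0, 1) - f (0, 1) (1, 0)) + g.1 • δ (f (1, 0) (0, 1) - f (0, 1) (1, 0))
        - f g (1, 0) + f g (0, 1) := by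
  have h1 := hf g (1, 0) (0, 1)
  have h2 := hf g (0, 1) (1, 0)
  rw [add_comm ((0 : ZMod 3), (1 : ZMod 3)) (1, 0)] at h2
  simp only [map_sub]
  linear_combination (norm := module) h1 - h2

/-- Norm in the first direction. -/
def nS (f : ZMod 3 × ZMod 3 → ZMod 3 × ZMod 3 → A) : A :=
  f (0, 0) (1, 0) + f (1, 0) (1, 0) + f (2, 0) (1, 0)

/-- Norm in the second direction. -/
def nT (f : ZMod 3 × ZMod 3 → ZMod 3 × ZMod 3 → A) : A :=
  f (0, 0) (0, 1) + f (0, 1) (0, 1) + f (0, 2) (0, 1)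

/-- Commutator. -/
def cST (f : ZMod 3 × ZMod 3 → ZMod 3 × ZMod 3 → A) : A :=
  f (1, 0) (0, 1) - f (0, 1) (1, 0)

lemma Coc2.nT_shift {δ : A →ₗ[ZMod 3] A} {f : ZMod 3 × ZMod 3 → ZMod 3 × ZMod 3 → A}
    (hf : Coc2 δ f) (i : ZMod 3) :
    f (i, 0) (0, 1) + f (i, 1) (0, 1) + f (i, 2) (0, 1) = nT f + i • δ (nT f) := by
  have h0 := hf (i, 0) (0, 0) (0, 1)
  have h1 := hf (i, 0) (0, 1) (0, 1)
  have h2 := hf (i, 0) (0, 2) (0, 1)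
  simp only [Prod.mk_add_mk, add_zero, zero_add, show (1 + 1 : ZMod 3) = 2 from rfl,
    show (2 + 1 : ZMod 3) = 0 from rfl] at h0 h1 h2
  simp only [nT, map_add]
  linear_combination (norm := module) h0 + h1 + h2

lemma Coc2.δ_nS {δ : A →ₗ[ZMod 3] A} {f : ZMod 3 × ZMod 3 → ZMod 3 × ZMod 3 → A}
    (hf : Coc2 δ f) : δ (nS f) = 0 := by
  have h0 := hf (1, 0) (0, 0) (1, 0)
  have h1 := hf (1, 0) (1, 0) (1, 0)
  have h2 := hf (1, 0) (2, 0) (1, 0)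
  simp only [Prod.mk_add_mk, add_zero, zero_add, show (1 + 1 : ZMod 3) = 2 from rfl,
    show (2 + 1 : ZMod 3) = 0 from rfl, show (1 + 2 : ZMod 3) = 0 from rfl, one_smul] at h0 h1 h2
  simp only [nS, map_add]
  linear_combination (norm := module) -h0 - h1 - h2

lemma Coc2.δ_nT {δ : A →ₗ[ZMod 3] A} {f : ZMod 3 × ZMod 3 → ZMod 3 × ZMod 3 → A}
    (hf : Coc2 δ f) : δ (nT f) = 0 := by
  have h := hf.nT_shift 1
  have h0 := hf.swap (0, 0)
  have h1 := hf.swap (0, 1)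
  have h2 := hf.swap (0, 2)
  have h3 := three_smul_zero (f (1, 0) (0, 1) - f (0, 1) (1, 0))
  simp only [Prod.mk_add_mk, add_zero, zero_add, show (1 + 1 : ZMod 3) = 2 from rfl,
    show (2 + 1 : ZMod 3) = 0 from rfl, zero_smul, one_smul] at h h0 h1 h2
  simp only [nT] at h ⊢
  linear_combination (norm := module) -h + h0 + h1 + h2 + h3

lemma Coc2.exists_dOne {δ : A →ₗ[ZMod 3] A} (hδ : ∀ a, δ (δ a) = 0)
    {f : ZMod 3 × ZMod 3 → ZMod 3 × ZMod 3 → A}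
    (hf : Coc2 δ f) (ha : nS f = 0) (hc : nT f = 0) (q : A) (hq : δ q = cST f) :
    ∃ p, ∀ g h, dOne δ p g h = f g h := by
  let S : ZMod 3 → A := ![0, f (0, 0) (1, 0), f (0, 0) (1, 0) + f (1, 0) (1, 0)]
  let T : ZMod 3 → ZMod 3 → A := fun i =>
    ![0, f (i, 0) (0, 1), f (i, 0) (0, 1) + f (i, 1) (0, 1)]
  have hS0 : S 0 = 0 := rfl
  have hT0 : ∀ i, T i 0 = 0 := fun i => rfl
  have hS : ∀ i, S (i + 1) = S i + f (i, 0) (1, 0) := by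
    intro i
    fin_cases i
    · exact (zero_add _).symm
    · rfl
    · exact ha.symm
  have hT : ∀ i j, T i (j + 1) = T i j + f (i, j) (0, 1) := by
    intro i j
    fin_cases j
    · exact (zero_add _).symm
    · rfl
    · have := hf.nT_shift i
      rw [hc, map_zero, smul_zero, add_zero] at this
      exact this.symm
  let p : ZMod 3 × ZMod 3 → A := fun g =>
    f 0 0 - S g.1 + g.2 • (q + g.1 • δ q) - T g.1 g.2
  have pt : ∀ g, p (g + (0, 1)) = p g + (q + g.1 • δ q) - f g (0, 1) := by
    rintro ⟨i, j⟩
    simp only [p, Prod.mk_add_mk, add_zero, hT]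
    module
  have ps0 : ∀ i, p ((i, 0) + (1, 0)) = p (i, 0) - f (i, 0) (1, 0) := by
    intro i
    simp only [p, Prod.mk_add_mk, add_zero, hS, hT0]
    module
  have step : ∀ g, p (g + (1, 0)) = p g - f g (1, 0) →
      p (g + (0, 1) + (1, 0)) = p (g + (0, 1)) - f (g + (0, 1)) (1, 0) := by
    intro g hg
    rw [add_right_comm, pt, pt, hg]
    have h1 := hf.swap g
    have h2 : δ (f (1, 0) (0, 1) - f (0, 1) (1, 0)) = 0 := by
      have : δ (δ q) = δ (cST f) := by rw [hq]
      rw [hδ] at this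
      exact this.symm
    rw [h2] at h1
    rw [Prod.fst_add]
    have hq' : δ q = f (1, 0) (0, 1) - f (0, 1) (1, 0) := hq
    simp only [smul_zero, add_smul, one_smul] at h1 ⊢
    linear_combination (norm := module) hq' - h1
  have ps : ∀ g, p (g + (1, 0)) = p g - f g (1, 0) := by
    rintro ⟨i, j⟩
    have e1 := step _ (ps0 i)
    have e2 := step _ e1
    simp only [Prod.mk_add_mk, add_zero, zero_add, show (1 + 1 : ZMod 3) = 2 from rfl] at e1 e2
    have hj : j = 0 ∨ j = 1 ∨ j = 2 := by
      clear * -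
      revert j; decide
    rw [Prod.mk_add_mk, add_zero]
    rcases hj with rfl | rfl | rfl
    · simpa using ps0 i
    · exact e1
    · exact e2
  have p10 : p (1, 0) = 0 := by
    have h := ps (0, 0)
    have h0 := hf.zero_left (1, 0)
    have h1 : p (0, 0) = f 0 0 := by simp [p, hS0, hT0]
    rw [h1] at h
    simp only [Prod.mk_add_mk, add_zero, zero_add] at h
    rw [h]
    exact sub_eq_zero.2 h0.symm
  have p01 : p (0, 1) = q := by
    have h := pt (0, 0)
    have h0 : f (0, 0) (0, 1) = f 0 0 := hf.zero_left (0, 1)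
    have h1 : p (0, 0) = f 0 0 := by simp [p, hS0, hT0]
    rw [h1, h0] at h
    simp only [Prod.mk_add_mk, add_zero, zero_add, zero_smul] at h
    rw [h]
    abel
  have hz := (hf.sub (coc2_dOne δ hδ p)).eq_zero
    (fun g => by
      simp only [dOne, p10, ps, map_zero, smul_zero]
      abel)
    (fun g => by
      simp only [dOne, p01, pt]
      abel)
  exact ⟨p, fun g h => (sub_eq_zero.1 (hz g h)).symm⟩

/-- The carry cocycle. -/
def carry (i k : ZMod 3) : ZMod 3 := if 3 ≤ i.val + k.val then 1 else 0

lemma carry_coc (i k l : ZMod 3) :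
    carry (i + k) l + carry i k = carry k l + carry i (k + l) := by
  revert i k l; decide

/-- The cocycle with prescribed invariants. -/
def mk2 (δ : A →ₗ[ZMod 3] A) (a b c : A) (g h : ZMod 3 × ZMod 3) : A :=
  carry g.1 h.1 • a + h.2 • (g.1 • b + (g.1 - g.1 ^ 2) • δ b) + carry g.2 h.2 • c

lemma coc2_mk2 {δ : A →ₗ[ZMod 3] A} (hδ : ∀ a, δ (δ a) = 0) {a b c : A} (ha : δ a = 0)
    (hc : δ c = 0) : Coc2 δ (mk2 δ a b c) := by
  rintro ⟨i, i'⟩ ⟨k, k'⟩ ⟨l, l'⟩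
  have h1 := carry_coc i k l
  have h2 := carry_coc i' k' l'
  have h3 : ((i + k) - (i + k) ^ 2) = (i - i ^ 2) + (k - k ^ 2) + i * k := by
    clear * -
    revert i k; decide
  simp only [mk2, map_add, map_smul, hδ, ha, hc, Prod.mk_add_mk, smul_zero, add_zero, zero_add, h3]
  have h1' := congrArg (fun t : ZMod 3 => t • a) h1
  have h2' := congrArg (fun t : ZMod 3 => t • c) h2
  linear_combination (norm := module) h1' + h2'

lemma nS_mk2 (δ : A →ₗ[ZMod 3] A) (a b c : A) : nS (mk2 δ a b c) = a := by
  simp [nS, mk2, show carry 0 1 = 0 from by decide, show carry 1 1 = 0 from by decide,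
    show carry 2 1 = 1 from by decide, show ∀ x, carry x 0 = 0 from by decide]

lemma nT_mk2 (δ : A →ₗ[ZMod 3] A) (a b c : A) : nT (mk2 δ a b c) = c := by
  simp [nT, mk2, show carry 0 1 = 0 from by decide, show carry 1 1 = 0 from by decide,
    show carry 2 1 = 1 from by decide, show ∀ x, carry x 0 = 0 from by decide]

lemma cST_mk2 (δ : A →ₗ[ZMod 3] A) (a b c : A) : cST (mk2 δ a b c) = b := by
  simp [cST, mk2, show carry 0 1 = 0 from by decide, show carry 1 0 = 0 from by decide]

lemma nS_dOne (δ : A →ₗ[ZMod 3] A) (p) : nS (dOne δ p) = 0 := by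
  have h3 := three_smul_zero (p (1, 0))
  have h4 := three_smul_zero (δ (p (1, 0)))
  simp only [nS, dOne, Prod.mk_add_mk, add_zero, zero_add, show (1 + 1 : ZMod 3) = 2 from rfl,
    show (2 + 1 : ZMod 3) = 0 from rfl, zero_smul, one_smul]
  linear_combination (norm := module) h3 + h4

lemma nT_dOne (δ : A →ₗ[ZMod 3] A) (p) : nT (dOne δ p) = 0 := by
  have h3 := three_smul_zero (p (0, 1))
  simp only [nT, dOne, Prod.mk_add_mk, add_zero, zero_add, show (1 + 1 : ZMod 3) = 2 from rfl,
    show (2 + 1 : ZMod 3) = 0 from rfl, zero_smul, one_smul]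
  linear_combination (norm := module) h3

lemma cST_dOne (δ : A →ₗ[ZMod 3] A) (p) : cST (dOne δ p) = δ (p (0, 1)) := by
  simp only [cST, dOne, Prod.mk_add_mk, add_zero, zero_add, zero_smul, one_smul]
  abel

end Pure

section Cohom

open groupCohomology

variable {A : Type} [AddCommGroup A] [Module (ZMod 3) A]

lemma finrank_eq_of_ker_eq {K Z H T : Type*} [Field K] [AddCommGroup Z] [Module K Z]
    [AddCommGroup H] [Module K H] [AddCommGroup T] [Module K T]
    (u : Z →ₗ[K] H) (v : Z →ₗ[K] T) (hu : Function.Surjective u) (hv : Function.Surjective v)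
    (h : ∀ z, u z = 0 ↔ v z = 0) : Module.finrank K H = Module.finrank K T := by
  have hk : LinearMap.ker u = LinearMap.ker v := by
    ext z
    simpa using h z
  have e1 := (u.quotKerEquivOfSurjective hu).finrank_eq
  have e2 := (v.quotKerEquivOfSurjective hv).finrank_eq
  rw [← e1, ← e2, hk]

/-- Invariants of a 2-cocycle. -/
noncomputable def inv2 (δ : A →ₗ[ZMod 3] A)
    (Z : Submodule (ZMod 3)
      (Multiplicative (ZMod 3 × ZMod 3) × Multiplicative (ZMod 3 × ZMod 3) → A))
    (hZ : ∀ z ∈ Z, Coc2 δ (fun g h => z (Multiplicative.ofAdd g, Multiplicative.ofAdd h))) :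
    Z →ₗ[ZMod 3] LinearMap.ker δ × (A ⧸ LinearMap.range δ) × LinearMap.ker δ where
  toFun z := (⟨nS (fun g h => z.1 (Multiplicative.ofAdd g, Multiplicative.ofAdd h)),
      (hZ z.1 z.2).δ_nS⟩,
    Submodule.Quotient.mk (cST (fun g h => z.1 (Multiplicative.ofAdd g, Multiplicative.ofAdd h))),
    ⟨nT (fun g h => z.1 (Multiplicative.ofAdd g, Multiplicative.ofAdd h)),
      (hZ z.1 z.2).δ_nT⟩)
  map_add' x y := by
    refine Prod.ext (Subtype.ext ?_) (Prod.ext ?_ (Subtype.ext ?_))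
    · simp only [nS, Submodule.coe_add, Pi.add_apply, Prod.fst_add]
      abel
    · simp only [Prod.snd_add, Prod.fst_add, ← Submodule.Quotient.mk_add]
      congr 1
      simp only [cST, Submodule.coe_add, Pi.add_apply]
      abel
    · simp only [nT, Submodule.coe_add, Pi.add_apply, Prod.snd_add]
      abel
  map_smul' c x := by
    refine Prod.ext (Subtype.ext ?_) (Prod.ext ?_ (Subtype.ext ?_))
    · simp only [nS, Submodule.coe_smul, Pi.smul_apply, Prod.smul_fst, smul_add, RingHom.id_apply]
    · simp only [Prod.smul_snd, Prod.smul_fst, ← Submodule.Quotient.mk_smul, RingHom.id_apply]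
      congr 1
      simp only [cST, Submodule.coe_smul, Pi.smul_apply, smul_sub]
    · simp only [nT, Submodule.coe_smul, Pi.smul_apply, Prod.smul_snd, smul_add, RingHom.id_apply]

theorem finrank_H2 (ρ : Representation (ZMod 3) (Multiplicative (ZMod 3 × ZMod 3)) A)
    (δ : A →ₗ[ZMod 3] A) (hδ : ∀ a, δ (δ a) = 0)
    (hρ : ∀ g a, ρ g a = a + (Multiplicative.toAdd g).1 • δ a) :
    Module.finrank (ZMod 3) (groupCohomology (Rep.of ρ) 2) =
      Module.finrank (ZMod 3)
        (LinearMap.ker δ × (A ⧸ LinearMap.range δ) × LinearMap.ker δ) := by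
  have hZ : ∀ z : Multiplicative (ZMod 3 × ZMod 3) × Multiplicative (ZMod 3 × ZMod 3) → A,
      z ∈ cocycles₂ (Rep.of ρ) ↔
      Coc2 δ (fun g h => z (Multiplicative.ofAdd g, Multiplicative.ofAdd h)) := by
    intro z
    rw [mem_cocycles₂_iff]
    refine forall_congr' fun g => forall_congr' fun h => forall_congr' fun j => ?_
    change z _ + z _ = ρ g _ + z _ ↔ _
    rw [hρ]
    rfl
  have hB : ∀ z : Multiplicative (ZMod 3 × ZMod 3) × Multiplicative (ZMod 3 × ZMod 3) → A,
      z ∈ coboundaries₂ (Rep.of ρ) ↔ ∃ p, ∀ g h, dOne δ p g h =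
        z (Multiplicative.ofAdd g, Multiplicative.ofAdd h) := by
    intro z
    constructor
    · rintro ⟨p, rfl⟩
      refine ⟨fun g => p (Multiplicative.ofAdd g), fun g h => ?_⟩
      change _ = ρ _ (p _) - p _ + p _
      rw [hρ]
      rfl
    · rintro ⟨p, hp⟩
      refine ⟨fun g => p (Multiplicative.toAdd g), ?_⟩
      funext x
      refine Eq.trans ?_ (hp (Multiplicative.toAdd x.1) (Multiplicative.toAdd x.2))
      change ρ _ (p _) - p _ + p _ = _
      rw [hρ]
      rfl
  refine finrank_eq_of_ker_eq (H2π (Rep.of ρ)).hom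
    (inv2 δ (cocycles₂ (Rep.of ρ)) (fun z hz => (hZ z).1 hz)) ?_ ?_ ?_
  · intro x
    induction x using H2_induction_on with
    | h x => exact ⟨x, rfl⟩
  · rintro ⟨⟨a, ha⟩, b, ⟨c, hc⟩⟩
    obtain ⟨b, rfl⟩ := Submodule.Quotient.mk_surjective _ b
    refine ⟨⟨fun x => mk2 δ a b c (Multiplicative.toAdd x.1) (Multiplicative.toAdd x.2),
      (hZ _).2 (coc2_mk2 hδ ha hc)⟩, ?_⟩
    refine Prod.ext (Subtype.ext ?_) (Prod.ext ?_ (Subtype.ext ?_))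
    · exact nS_mk2 δ a b c
    · exact congrArg Submodule.Quotient.mk (cST_mk2 δ a b c)
    · exact nT_mk2 δ a b c
  · intro z
    refine (H2π_eq_zero_iff z).trans ((hB z.1).trans ?_)
    constructor
    · rintro ⟨p, hp⟩
      have hp' : (fun g h => z.1 (Multiplicative.ofAdd g, Multiplicative.ofAdd h)) = dOne δ p := by
        funext g h
        exact (hp g h).symm
      refine Prod.ext (Subtype.ext ?_) (Prod.ext ?_ (Subtype.ext ?_))
      · change nS (fun g h => z.1 (Multiplicative.ofAdd g, Multiplicative.ofAdd h)) = 0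
        rw [hp', nS_dOne]
      · change Submodule.Quotient.mk
          (cST (fun g h => z.1 (Multiplicative.ofAdd g, Multiplicative.ofAdd h))) = 0
        rw [hp', cST_dOne, Submodule.Quotient.mk_eq_zero]
        exact ⟨_, rfl⟩
      · change nT (fun g h => z.1 (Multiplicative.ofAdd g, Multiplicative.ofAdd h)) = 0
        rw [hp', nT_dOne]
    · intro h
      have h1 := congrArg (fun x => (x.1 : A)) h
      have h2 := congrArg (fun x => x.2.1) h
      have h3 := congrArg (fun x => (x.2.2 : A)) h
      obtain ⟨q, hq⟩ := (Submodule.Quotient.mk_eq_zero _).1 h2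
      exact ((hZ z.1).1 z.2).exists_dOne hδ h1 h3 q hq

/-- Invariants of a 1-cocycle. -/
noncomputable def inv1 (δ : A →ₗ[ZMod 3] A)
    (Z : Submodule (ZMod 3) (Multiplicative (ZMod 3 × ZMod 3) → A))
    (hZ : ∀ z ∈ Z, δ (z (Multiplicative.ofAdd (0, 1))) = 0) :
    Z →ₗ[ZMod 3] (A ⧸ LinearMap.range δ) × LinearMap.ker δ where
  toFun z := (Submodule.Quotient.mk (z.1 (Multiplicative.ofAdd (1, 0))),
    ⟨z.1 (Multiplicative.ofAdd (0, 1)), hZ z.1 z.2⟩)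
  map_add' _ _ := rfl
  map_smul' _ _ := rfl

theorem finrank_H1 (ρ : Representation (ZMod 3) (Multiplicative (ZMod 3 × ZMod 3)) A)
    (δ : A →ₗ[ZMod 3] A) (hδ : ∀ a, δ (δ a) = 0)
    (hρ : ∀ g a, ρ g a = a + (Multiplicative.toAdd g).1 • δ a) :
    Module.finrank (ZMod 3) (groupCohomology (Rep.of ρ) 1) =
      Module.finrank (ZMod 3) ((A ⧸ LinearMap.range δ) × LinearMap.ker δ) := by
  have hZ : ∀ z : Multiplicative (ZMod 3 × ZMod 3) → A,
      z ∈ cocycles₁ (Rep.of ρ) ↔ ∀ g h : ZMod 3 × ZMod 3,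
      z (Multiplicative.ofAdd (g + h)) = z (Multiplicative.ofAdd h) +
        g.1 • δ (z (Multiplicative.ofAdd h)) + z (Multiplicative.ofAdd g) := by
    intro z
    rw [mem_cocycles₁_iff]
    refine forall_congr' fun g => forall_congr' fun h => ?_
    change z _ = ρ g _ + z _ ↔ _
    rw [hρ]
    rfl
  have hB : ∀ z : Multiplicative (ZMod 3 × ZMod 3) → A,
      z ∈ coboundaries₁ (Rep.of ρ) ↔ ∃ a, ∀ g : ZMod 3 × ZMod 3,
        g.1 • δ a = z (Multiplicative.ofAdd g) := by
    intro z
    have key : ∀ a g, ρ g a - a = (Multiplicative.toAdd g).1 • δ a := by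
      intro a g
      rw [hρ]
      abel
    constructor
    · rintro ⟨a, rfl⟩
      exact ⟨a, fun g => (key a (Multiplicative.ofAdd g)).symm⟩
    · rintro ⟨a, ha⟩
      refine ⟨a, ?_⟩
      funext x
      exact (key a x).trans (ha (Multiplicative.toAdd x))
  refine finrank_eq_of_ker_eq (H1π (Rep.of ρ)).hom
    (inv1 δ (cocycles₁ (Rep.of ρ)) (fun z hz => ?_)) ?_ ?_ ?_
  · have h1 := (hZ z).1 hz (1, 0) (0, 1)
    have h2 := (hZ z).1 hz (0, 1) (1, 0)
    rw [add_comm ((0 : ZMod 3), (1 : ZMod 3)) (1, 0), h1] at h2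
    simp only [one_smul, zero_smul] at h2
    linear_combination (norm := module) h2
  · intro x
    induction x using H1_induction_on with
    | h x => exact ⟨x, rfl⟩
  · rintro ⟨a, ⟨b, hb⟩⟩
    obtain ⟨a, rfl⟩ := Submodule.Quotient.mk_surjective _ a
    have hb' : δ b = 0 := hb
    refine ⟨⟨fun x => (Multiplicative.toAdd x).1 • a +
      ((Multiplicative.toAdd x).1 - (Multiplicative.toAdd x).1 ^ 2) • δ a +
      (Multiplicative.toAdd x).2 • b, (hZ _).2 ?_⟩, ?_⟩
    · rintro ⟨i, i'⟩ ⟨k, k'⟩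
      have h3 : ((i + k) - (i + k) ^ 2) = (i - i ^ 2) + (k - k ^ 2) + i * k := by
        clear * -
        revert i k; decide
      simp only [toAdd_ofAdd, Prod.mk_add_mk, map_add, map_smul, hδ, hb', h3]
      module
    · refine Prod.ext ?_ (Subtype.ext ?_)
      · refine congrArg Submodule.Quotient.mk ?_
        simp
      · change (0 : ZMod 3) • a + ((0 : ZMod 3) - 0 ^ 2) • δ a + (1 : ZMod 3) • b = b
        simp
  · intro z
    refine (H1π_eq_zero_iff z).trans ((hB z.1).trans ?_)
    constructor
    · rintro ⟨a, ha⟩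
      refine Prod.ext ?_ (Subtype.ext ?_)
      · refine (Submodule.Quotient.mk_eq_zero _).2 ⟨a, ?_⟩
        rw [← ha, one_smul]
      · exact (ha (0, 1)).symm.trans (zero_smul _ _)
    · intro h
      have h1 := congrArg (fun x => x.1) h
      have h2 : z.1 (Multiplicative.ofAdd (0, 1)) = 0 := congrArg (fun x => (x.2 : A)) h
      obtain ⟨a, ha⟩ := (Submodule.Quotient.mk_eq_zero _).1 h1
      have hz := (hZ z.1).1 z.2
      refine ⟨a, ?_⟩
      have hs : ∀ g, z.1 (Multiplicative.ofAdd (g + (1, 0))) =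
          δ a + z.1 (Multiplicative.ofAdd g) := by
        intro g
        rw [hz, ← ha, hδ]
        simp
      have ht : ∀ g, z.1 (Multiplicative.ofAdd (g + (0, 1))) =
          z.1 (Multiplicative.ofAdd g) := by
        intro g
        rw [hz, h2]
        simp
      have h0 : z.1 (Multiplicative.ofAdd (0, 0)) = 0 := by
        have := hz (0, 0) (0, 0)
        simpa using this
      have hc : ∀ j : ZMod 3, j = 0 ∨ j = 1 ∨ j = 2 := by decide
      have hi : ∀ i : ZMod 3, i • δ a = z.1 (Multiplicative.ofAdd (i, 0)) := by
        have e1 : z.1 (Multiplicative.ofAdd (1, 0)) = δ a := by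
          have := hs (0, 0)
          rw [h0, add_zero] at this
          exact this
        have e2 : z.1 (Multiplicative.ofAdd (2, 0)) = δ a + δ a := by
          have := hs (1, 0)
          rw [e1] at this
          exact this
        intro i
        rcases hc i with rfl | rfl | rfl
        · rw [h0, zero_smul]
        · rw [e1, one_smul]
        · rw [e2]; module
      rintro ⟨i, j⟩
      have e1 : z.1 (Multiplicative.ofAdd (i, 1)) = z.1 (Multiplicative.ofAdd (i, 0)) := by
        have := ht (i, 0)
        rwa [Prod.mk_add_mk, add_zero, zero_add] at this
      have e2 : z.1 (Multiplicative.ofAdd (i, 2)) = z.1 (Multiplicative.ofAdd (i, 1)) := by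
        have := ht (i, 1)
        rwa [Prod.mk_add_mk, add_zero] at this
      rcases hc j with rfl | rfl | rfl
      · exact hi i
      · rw [e1]; exact hi i
      · rw [e2, e1]; exact hi i

end Cohom

section Lam

lemma eGen_pow3 : eGen ^ 3 = 1 := by
  rw [eGen, AddMonoidAlgebra.single_pow]
  rw [show (3 • ((1 : ZMod 3), (0 : ZMod 3))) = 0 from by decide, one_pow]
  rfl

lemma fGen_pow3 : fGen ^ 3 = 1 := by
  rw [fGen, AddMonoidAlgebra.single_pow]
  rw [show (3 • ((0 : ZMod 3), (1 : ZMod 3))) = 0 from by decide, one_pow]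
  rfl

lemma three_lam : (3 : Lam3) = 0 := by
  have h := three_smul_zero (1 : Lam3)
  linear_combination h

lemma coeff_eGen_mul (m : Lam3) (i j : ZMod 3) :
    (eGen * m).coeff (i, j) = m.coeff (i - 1, j) := by
  rw [eGen, AddMonoidAlgebra.coeff_single_mul_apply, one_mul]
  congr 1
  simp [sub_eq_neg_add]

lemma coeff_fGen_mul (m : Lam3) (i j : ZMod 3) :
    (fGen * m).coeff (i, j) = m.coeff (i, j - 1) := by
  rw [fGen, AddMonoidAlgebra.coeff_single_mul_apply, one_mul]
  congr 1
  simp [sub_eq_neg_add]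

lemma coeff_E_mul {m : Lam3} (h : (1 + eGen + eGen ^ 2) * m = 0) (j : ZMod 3) :
    m.coeff (2, j) + m.coeff (1, j) + m.coeff (0, j) = 0 := by
  have h1 : m + eGen * m + eGen * (eGen * m) = 0 := by rw [← h]; ring
  have h2 := congrArg (fun x : Lam3 => x.coeff (2, j)) h1
  simp only [AddMonoidAlgebra.coeff_add, Finsupp.add_apply, coeff_eGen_mul] at h2
  exact h2

lemma coeff_F_mul {m : Lam3} (h : (1 + fGen + fGen ^ 2) * m = 0) (i : ZMod 3) :
    m.coeff (i, 2) + m.coeff (i, 1) + m.coeff (i, 0) = 0 := by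
  have h1 : m + fGen * m + fGen * (fGen * m) = 0 := by rw [← h]; ring
  have h2 := congrArg (fun x : Lam3 => x.coeff (i, 2)) h1
  simp only [AddMonoidAlgebra.coeff_add, Finsupp.add_apply, coeff_fGen_mul] at h2
  exact h2

lemma zmod3_cases (j : ZMod 3) : j = 0 ∨ j = 1 ∨ j = 2 := by
  revert j; decide

lemma lam_ext {m n : Lam3} (h : ∀ i j, m.coeff (i, j) = n.coeff (i, j)) : m = n := by
  apply AddMonoidAlgebra.coeff_injective
  ext ⟨i, j⟩
  exact h i j

/-- four coefficients -/
noncomputable def four (V : Submodule (ZMod 3) Lam3) :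
    V →ₗ[ZMod 3] ZMod 3 × ZMod 3 × ZMod 3 × ZMod 3 where
  toFun m := (m.1.coeff (0, 0), m.1.coeff (0, 1), m.1.coeff (1, 0), m.1.coeff (1, 1))
  map_add' _ _ := rfl
  map_smul' _ _ := rfl

lemma coeff_ef (a b : ℕ) (i j : ZMod 3) : (eGen ^ a * fGen ^ b).coeff (i, j) =
    if ((a : ZMod 3), (b : ZMod 3)) = (i, j) then 1 else 0 := by
  rw [eGen, fGen, AddMonoidAlgebra.single_pow, AddMonoidAlgebra.single_pow,
    AddMonoidAlgebra.single_mul_single, AddMonoidAlgebra.coeff_single, Finsupp.single_apply]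
  simp

/-- Coefficients of `(e^a - e^2)(f^b - f^2)`. -/
def cq (a b : ℕ) (i j : ZMod 3) : ZMod 3 :=
  (if ((a : ZMod 3), (b : ZMod 3)) = (i, j) then 1 else 0) -
    (if ((2 : ZMod 3), (b : ZMod 3)) = (i, j) then 1 else 0) -
    (if ((a : ZMod 3), (2 : ZMod 3)) = (i, j) then 1 else 0) +
    (if ((2 : ZMod 3), (2 : ZMod 3)) = (i, j) then 1 else 0)

lemma coeff_q (a b : ℕ) (i j : ZMod 3) :
    (eGen ^ a * fGen ^ b - eGen ^ 2 * fGen ^ b - eGen ^ a * fGen ^ 2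
        + eGen ^ 2 * fGen ^ 2).coeff (i, j) = cq a b i j := by
  rw [AddMonoidAlgebra.coeff_add, AddMonoidAlgebra.coeff_sub, AddMonoidAlgebra.coeff_sub,
    Finsupp.add_apply, Finsupp.sub_apply, Finsupp.sub_apply, coeff_ef, coeff_ef, coeff_ef,
    coeff_ef]
  rfl

lemma finrank_V (V : Submodule (ZMod 3) Lam3)
    (hV : ∀ m : Lam3, m ∈ V ↔
      (1 + eGen + eGen ^ 2) * m = 0 ∧ (1 + fGen + fGen ^ 2) * m = 0) : Module.finrank (ZMod 3) V = 4 := by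
  have e3 := eGen_pow3
  have f3 := fGen_pow3
  have hinj : Function.Injective (four V) := by
    rw [injective_iff_map_eq_zero]
    rintro ⟨m, hm⟩ h
    obtain ⟨he, hf⟩ := (hV m).1 hm
    have h00 : m.coeff (0, 0) = 0 := congrArg (fun x => x.1) h
    have h01 : m.coeff (0, 1) = 0 := congrArg (fun x => x.2.1) h
    have h10 : m.coeff (1, 0) = 0 := congrArg (fun x => x.2.2.1) h
    have h11 : m.coeff (1, 1) = 0 := congrArg (fun x => x.2.2.2) h
    have h20 := coeff_E_mul he 0
    have h21 := coeff_E_mul he 1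
    have h02 := coeff_F_mul hf 0
    have h12 := coeff_F_mul hf 1
    have h22 := coeff_F_mul hf 2
    simp only [h00, h01, h10, h11, add_zero] at h20 h21 h02 h12
    simp only [h20, h21, add_zero] at h22
    refine Subtype.ext (lam_ext fun i j => ?_)
    rcases zmod3_cases i with rfl | rfl | rfl <;> rcases zmod3_cases j with rfl | rfl | rfl <;>
      simpa
  have hsurj : Function.Surjective (four V) := by
    have key : ∀ a b : ℕ, eGen ^ a * fGen ^ b - eGen ^ 2 * fGen ^ b - eGen ^ a * fGen ^ 2
        + eGen ^ 2 * fGen ^ 2 = (eGen ^ a - eGen ^ 2) * (fGen ^ b - fGen ^ 2) := by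
      intro a b; ring
    rintro ⟨a, b, c, d⟩
    have hm : ∀ i ∈ ({0, 1} : Set ℕ), ∀ j ∈ ({0, 1} : Set ℕ),
        eGen ^ i * fGen ^ j - eGen ^ 2 * fGen ^ j - eGen ^ i * fGen ^ 2
        + eGen ^ 2 * fGen ^ 2 ∈ V := by
      have hE : ∀ i ∈ ({0, 1} : Set ℕ), (1 + eGen + eGen ^ 2) * (eGen ^ i - eGen ^ 2) = 0 := by
        rintro i (rfl | rfl)
        · linear_combination (-1 - eGen) * e3
        · linear_combination (- eGen) * e3
      have hF : ∀ i ∈ ({0, 1} : Set ℕ), (1 + fGen + fGen ^ 2) * (fGen ^ i - fGen ^ 2) = 0 := by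
        rintro i (rfl | rfl)
        · linear_combination (-1 - fGen) * f3
        · linear_combination (- fGen) * f3
      intro i hi j hj
      rw [hV, key]
      constructor
      · rw [← mul_assoc, hE i hi, zero_mul]
      · rw [mul_left_comm, hF j hj, mul_zero]
    have hv : ∀ (i j : ℕ) (hi : i ∈ ({0, 1} : Set ℕ)) (hj : j ∈ ({0, 1} : Set ℕ)),
        four V ⟨_, hm i hi j hj⟩ = (cq i j 0 0, cq i j 0 1, cq i j 1 0, cq i j 1 1) := by
      intro i j hi hj
      rw [← coeff_q, ← coeff_q, ← coeff_q, ← coeff_q]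
      rfl
    have h0 : (0 : ℕ) ∈ ({0, 1} : Set ℕ) := by simp
    have h1 : (1 : ℕ) ∈ ({0, 1} : Set ℕ) := by simp
    have v00 : four V ⟨_, hm 0 h0 0 h0⟩ = (1, 0, 0, 0) := (hv 0 0 h0 h0).trans (by decide)
    have v01 : four V ⟨_, hm 0 h0 1 h1⟩ = (0, 1, 0, 0) := (hv 0 1 h0 h1).trans (by decide)
    have v10 : four V ⟨_, hm 1 h1 0 h0⟩ = (0, 0, 1, 0) := (hv 1 0 h1 h0).trans (by decide)
    have v11 : four V ⟨_, hm 1 h1 1 h1⟩ = (0, 0, 0, 1) := (hv 1 1 h1 h1).trans (by decide)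
    refine ⟨a • ⟨_, hm 0 h0 0 h0⟩ + b • ⟨_, hm 0 h0 1 h1⟩ +
      c • ⟨_, hm 1 h1 0 h0⟩ + d • ⟨_, hm 1 h1 1 h1⟩, ?_⟩
    rw [map_add, map_add, map_add, map_smul, map_smul, map_smul, map_smul, v00, v01, v10, v11]
    simp
  rw [(LinearEquiv.ofBijective (four V) ⟨hinj, hsurj⟩).finrank_eq]
  simp

lemma Bsig_mul {m : Lam3} (he : (1 + eGen + eGen ^ 2) * m = 0)
    (hf : (1 + fGen + fGen ^ 2) * m = 0) :
    Bsig * m = m + (1 - eGen) * (1 - fGen) * m := by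
  have h3 := three_lam
  rw [Bsig]
  linear_combination (1 - fGen) * he + (1 - eGen) * hf -
    (eGen * (1 - fGen) + (1 - eGen) * fGen + (1 - eGen) * (1 - fGen)) * m * h3

lemma Btau_mul {m : Lam3} (he : (1 + eGen + eGen ^ 2) * m = 0)
    (hf : (1 + fGen + fGen ^ 2) * m = 0) : Btau * m = m := by
  have h3 := three_lam
  rw [Btau]
  linear_combination (fGen ^ 2 - 1) * he - (2 + eGen) * hf + (1 + eGen + fGen) * m * h3

lemma w_fix_e {m : Lam3} (he : (1 + eGen + eGen ^ 2) * m = 0) :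
    eGen * ((1 - eGen) * (1 - fGen) * m) = (1 - eGen) * (1 - fGen) * m := by
  have h3 := three_lam
  linear_combination -(1 - fGen) * he + eGen * (1 - fGen) * m * h3

lemma w_fix_f {m : Lam3} (hf : (1 + fGen + fGen ^ 2) * m = 0) :
    fGen * ((1 - eGen) * (1 - fGen) * m) = (1 - eGen) * (1 - fGen) * m := by
  have h3 := three_lam
  linear_combination -(1 - eGen) * hf + fGen * (1 - eGen) * m * h3

lemma coeff_const {u : Lam3} (he : eGen * u = u) (hf : fGen * u = u) (i j : ZMod 3) :
    u.coeff (i, j) = u.coeff (0, 0) := by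
  have h1 : ∀ i j, u.coeff (i, j) = u.coeff (i - 1, j) := fun i j => by
    rw [← coeff_eGen_mul, he]
  have h2 : ∀ i j, u.coeff (i, j) = u.coeff (i, j - 1) := fun i j => by
    rw [← coeff_fGen_mul, hf]
  have h3 : ∀ j, u.coeff (i, j) = u.coeff (0, j) := by
    intro j
    rcases zmod3_cases i with rfl | rfl | rfl
    · rfl
    · exact h1 1 j
    · exact (h1 2 j).trans (h1 1 j)
  rw [h3]
  rcases zmod3_cases j with rfl | rfl | rfl
  · rfl
  · exact h2 0 1
  · exact (h2 0 2).trans (h2 0 1)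

end Lam

/-- Let `G = ℤ/3 × ℤ/3` act `𝔽₃`-linearly on `Λ₁` by `(a,b)·m = B_σ^a B_τ^b m`, and let
`V = {m ∈ Λ₁ : (1+e+e²)m = 0 ∧ (1+f+f²)m = 0}`, a `G`-stable subspace of dimension `4`
(the Galois module `H₁(U; ℤ/3)` of the affine Fermat cubic).  Then `H¹(G, V)` has dimension
`6` and `H²(G, V)` has dimension `9` over `𝔽₃`. -/
theorem stmt_18
    (V : Submodule (ZMod 3) Lam3)
    (hV : ∀ m : Lam3, m ∈ V ↔
      (1 + eGen + eGen ^ 2) * m = 0 ∧ (1 + fGen + fGen ^ 2) * m = 0)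
    (ρ : Representation (ZMod 3) (Multiplicative (ZMod 3 × ZMod 3)) V)
    (hρ : ∀ (g : Multiplicative (ZMod 3 × ZMod 3)) (v : V),
      ((ρ g v : Lam3)) = Bsig ^ ((Multiplicative.toAdd g).1.val) *
        Btau ^ ((Multiplicative.toAdd g).2.val) * (v : Lam3)) :
    Module.finrank (ZMod 3) V = 4 ∧
    Module.finrank (ZMod 3) (groupCohomology (Rep.of ρ) 1) = 6 ∧
      Module.finrank (ZMod 3) (groupCohomology (Rep.of ρ) 2) = 9 := by
  have h4 := finrank_V V hV
  haveI : FiniteDimensional (ZMod 3) V := Module.finite_of_finrank_pos (by rw [h4]; norm_num)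
  have e3 := eGen_pow3
  have f3 := fGen_pow3
  let δ : V →ₗ[ZMod 3] V := ρ (Multiplicative.ofAdd (1, 0)) - 1
  have hδc : ∀ v : V, (δ v : Lam3) = (1 - eGen) * (1 - fGen) * v := by
    intro v
    obtain ⟨he, hf⟩ := (hV v).1 v.2
    have h1 : (δ v : Lam3) = (ρ (Multiplicative.ofAdd (1, 0)) v : Lam3) - v := rfl
    rw [h1, hρ]
    have h2 : ((Multiplicative.toAdd (Multiplicative.ofAdd ((1 : ZMod 3), (0 : ZMod 3)))).1.val) = 1 :=
      rfl
    have h3 : ((Multiplicative.toAdd (Multiplicative.ofAdd ((1 : ZMod 3), (0 : ZMod 3)))).2.val) = 0 :=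
      rfl
    rw [h2, h3, pow_one, pow_zero, mul_one, Bsig_mul he hf]
    ring
  have hfe : ∀ v : V, eGen * (δ v : Lam3) = δ v := fun v => by
    rw [hδc]; exact w_fix_e ((hV v).1 v.2).1
  have hff : ∀ v : V, fGen * (δ v : Lam3) = δ v := fun v => by
    rw [hδc]; exact w_fix_f ((hV v).1 v.2).2
  have hδ : ∀ a, δ (δ a) = 0 := by
    intro a
    apply Subtype.ext
    rw [hδc, ZeroMemClass.coe_zero]
    linear_combination (-(1 - fGen)) * hfe a
  have hρ' : ∀ g a, ρ g a = a + (Multiplicative.toAdd g).1 • δ a := by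
    intro g a
    apply Subtype.ext
    have hT : ∀ n : ℕ, Btau ^ n * (a : Lam3) = a := by
      intro n
      induction n with
      | zero => simp
      | succ n ih => rw [pow_succ, mul_assoc, Btau_mul ((hV a).1 a.2).1 ((hV a).1 a.2).2, ih]
    have hB : ∀ v : V, Bsig * (v : Lam3) = ((v + δ v : V) : Lam3) := by
      intro v
      rw [Submodule.coe_add, hδc, Bsig_mul ((hV v).1 v.2).1 ((hV v).1 v.2).2]
    rw [hρ, mul_assoc, hT]
    rcases zmod3_cases (Multiplicative.toAdd g).1 with h | h | h
    · rw [h, show (0 : ZMod 3).val = 0 from rfl]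
      simp
    · rw [h, show (1 : ZMod 3).val = 1 from rfl, pow_one, hB, one_smul]
    · rw [h, show (2 : ZMod 3).val = 2 from rfl, pow_two, mul_assoc, hB, hB]
      congr 1
      rw [map_add, hδ]
      module
  have hr : Module.finrank (ZMod 3) (LinearMap.range δ) = 1 := by
    have hw : (1 - eGen) * (1 - fGen) ∈ V := by
      rw [hV]
      constructor
      · linear_combination -(1 - fGen) * e3
      · linear_combination -(1 - eGen) * f3
    have hc : (δ ⟨_, hw⟩ : Lam3).coeff (0, 0) = 1 := by
      rw [hδc]
      have h9 : (1 - eGen) * (1 - fGen) * ((1 - eGen) * (1 - fGen)) =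
          eGen ^ 0 * fGen ^ 0 + eGen ^ 1 * fGen ^ 0 + eGen ^ 2 * fGen ^ 0 +
          eGen ^ 0 * fGen ^ 1 + eGen ^ 1 * fGen ^ 1 + eGen ^ 2 * fGen ^ 1 +
          eGen ^ 0 * fGen ^ 2 + eGen ^ 1 * fGen ^ 2 + eGen ^ 2 * fGen ^ 2 := by
        have h3 := three_lam
        linear_combination (-fGen * (1 + eGen + eGen ^ 2) - eGen * (1 - fGen) ^ 2) * h3
      change ((1 - eGen) * (1 - fGen) * ((1 - eGen) * (1 - fGen))).coeff (0, 0) = 1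
      rw [h9]
      simp only [AddMonoidAlgebra.coeff_add, Finsupp.add_apply, coeff_ef]
      decide
    refine finrank_eq_one_iff'.2 ⟨⟨δ ⟨_, hw⟩, ⟨_, rfl⟩⟩, ?_, ?_⟩
    · intro h
      have h' : (δ ⟨_, hw⟩ : Lam3) = 0 :=
        congrArg (fun x : LinearMap.range δ => ((x : V) : Lam3)) h
      rw [h'] at hc
      exact absurd hc (by simp)
    · rintro ⟨_, v, rfl⟩
      refine ⟨(δ v : Lam3).coeff (0, 0), Subtype.ext (Subtype.ext (lam_ext fun i j => ?_))⟩
      rw [coeff_const (hfe v) (hff v) i j]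
      change (δ v : Lam3).coeff (0, 0) * (δ ⟨_, hw⟩ : Lam3).coeff (i, j) = _
      rw [coeff_const (hfe _) (hff _) i j, hc, mul_one]
  have hrk := δ.finrank_range_add_finrank_ker
  have hq := (LinearMap.range δ).finrank_quotient_add_finrank
  refine ⟨h4, ?_, ?_⟩
  · rw [finrank_H1 ρ δ hδ hρ', Module.finrank_prod]
    omega
  · rw [finrank_H2 ρ δ hδ hρ', Module.finrank_prod, Module.finrank_prod]
    omega
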